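/- Let n ≥ 2, k = 2^n, and let e ⊆ {1,…,n} be a two-element set. Then the intersection of the projection of P^∅_n onto (y_1,z_1) with the projection P̄^e_n of P^e_n onto (y_1,z_1) equals the topological closure of Q_{2^n} \\ ⋃_{ℓ : e ⊆ S_ℓ} Δ_ℓ, where Δ_ℓ is the closed triangle with vertices w_{ℓ−1}, v_ℓ, and w_ℓ (indices taken mod k). -/

import Mathlib

open Real MeasureTheory Matrix

/-- The clockwise rotation matrix by angle `π / 2 ^ j` (this is `R_{j+1}` in 1-based indexing). -/
noncomputable def rotM (j : ℕ) : Matrix (Fin 2) (Fin 2) ℝ :=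
  !![Real.cos (Real.pi / 2 ^ j), Real.sin (Real.pi / 2 ^ j);
     -Real.sin (Real.pi / 2 ^ j), Real.cos (Real.pi / 2 ^ j)]

/-- The reflection with respect to the first axis. -/
def reflM : Matrix (Fin 2) (Fin 2) ℝ := !![1, 0; 0, -1]

/-- The vertex `v_ℓ = sec(π/2^n) (cos((2ℓ+1)π/2^n), sin((2ℓ+1)π/2^n))` of the regular `2^n`-gon. -/
noncomputable def vtx (n ℓ : ℕ) : Fin 2 → ℝ :=
  (Real.cos (Real.pi / 2 ^ n))⁻¹ •
    ![Real.cos ((2 * ℓ + 1) * Real.pi / 2 ^ n), Real.sin ((2 * ℓ + 1) * Real.pi / 2 ^ n)]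

/-- The facet midpoint `w_ℓ = (cos((2ℓ+2)π/2^n), sin((2ℓ+2)π/2^n))`. -/
noncomputable def wpt (n ℓ : ℕ) : Fin 2 → ℝ :=
  ![Real.cos ((2 * ℓ + 2) * Real.pi / 2 ^ n), Real.sin ((2 * ℓ + 2) * Real.pi / 2 ^ n)]

/-- `chainAux n b x i = R^{b_i} R_i ⋯ R^{b_1} R_1 x` (1-based indexing of `b` and `R`). -/
noncomputable def chainAux (n : ℕ) (b : Fin n → Fin 2) (x : Fin 2 → ℝ) : ℕ → Fin 2 → ℝ
  | 0 => x
  | i + 1 =>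
    if h : i < n then
      (reflM ^ ((b ⟨i, h⟩ : Fin 2) : ℕ)) *ᵥ (rotM i *ᵥ chainAux n b x i)
    else chainAux n b x i
/-- The polyhedron `P^∅_n` in the space of pairs `(y, z)` (0-based: `y i` is `y_{i+1}`). -/
def Pempty (n : ℕ) : Set ((Fin (n + 1) → ℝ) × (Fin (n + 1) → ℝ)) :=
  {p | (∀ i : Fin n,
        p.1 i.succ = Real.cos (Real.pi / 2 ^ (i : ℕ)) * p.1 i.castSucc
            + Real.sin (Real.pi / 2 ^ (i : ℕ)) * p.2 i.castSucc ∧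
        p.2 i.succ ≥ -Real.sin (Real.pi / 2 ^ (i : ℕ)) * p.1 i.castSucc
            + Real.cos (Real.pi / 2 ^ (i : ℕ)) * p.2 i.castSucc ∧
        p.2 i.succ ≥ Real.sin (Real.pi / 2 ^ (i : ℕ)) * p.1 i.castSucc
            - Real.cos (Real.pi / 2 ^ (i : ℕ)) * p.2 i.castSucc) ∧
    p.1 (Fin.last n) ≤ 1 ∧
    Real.cos (Real.pi / 2 ^ (n - 1)) * p.1 (Fin.last n)
        + Real.sin (Real.pi / 2 ^ (n - 1)) * p.2 (Fin.last n) ≤ 1}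

/-- The polyhedron `P^e_n` for an edge `e` (0-based indexing of `{1,…,n}` as `Fin n`). -/
def Pe (n : ℕ) (e : Finset (Fin n)) : Set ((Fin (n + 1) → ℝ) × (Fin (n + 1) → ℝ)) :=
  {p | (∀ i : Fin n,
        p.1 i.succ = Real.cos (Real.pi / 2 ^ (i : ℕ)) * p.1 i.castSucc
            + Real.sin (Real.pi / 2 ^ (i : ℕ)) * p.2 i.castSucc ∧
        (if i ∈ e then
          p.2 i.succ = -Real.sin (Real.pi / 2 ^ (i : ℕ)) * p.1 i.castSucc
              + Real.cos (Real.pi / 2 ^ (i : ℕ)) * p.2 i.castSucc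
        else
          p.2 i.succ ≥ -Real.sin (Real.pi / 2 ^ (i : ℕ)) * p.1 i.castSucc
              + Real.cos (Real.pi / 2 ^ (i : ℕ)) * p.2 i.castSucc ∧
          p.2 i.succ ≥ Real.sin (Real.pi / 2 ^ (i : ℕ)) * p.1 i.castSucc
              - Real.cos (Real.pi / 2 ^ (i : ℕ)) * p.2 i.castSucc)) ∧
    Real.cos (Real.pi / 2 ^ n) * p.1 (Fin.last n)
        + Real.sin (Real.pi / 2 ^ n) * p.2 (Fin.last n) ≤ Real.cos (Real.pi / 2 ^ n)}

/-- Projection of a pair `(y, z)` to the coordinates `(y_1, z_1)`. -/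
def proj2 {n : ℕ} (p : (Fin (n + 1) → ℝ) × (Fin (n + 1) → ℝ)) : Fin 2 → ℝ :=
  ![p.1 0, p.2 0]

/-- The regular `2^n`-gon `Q_{2^n}`, as the convex hull of its vertices. -/
def Qgon (n : ℕ) : Set (Fin 2 → ℝ) :=
  convexHull ℝ {x | ∃ ℓ < 2 ^ n, x = vtx n ℓ}

/-- The triangle `Δ_ℓ` spanned by `w_{ℓ-1}`, `v_ℓ` and `w_ℓ` (indices mod `2^n`). -/
def tri (n ℓ : ℕ) : Set (Fin 2 → ℝ) :=
  convexHull ℝ {wpt n (ℓ + 2 ^ n - 1), vtx n ℓ, wpt n ℓ}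


/-- The inner product of `x` with the unit vector at angle `φ`. -/
noncomputable def dir (φ : ℝ) (x : Fin 2 → ℝ) : ℝ := cos φ * x 0 + sin φ * x 1

theorem continuous_dir (φ : ℝ) : Continuous (dir φ) := by
  unfold dir
  fun_prop

theorem dir_smul (φ t : ℝ) (x : Fin 2 → ℝ) : dir φ (t • x) = t * dir φ x := by
  simp only [dir, Pi.smul_apply, smul_eq_mul]
  ring

theorem dir_add (φ : ℝ) (x y : Fin 2 → ℝ) : dir φ (x + y) = dir φ x + dir φ y := by
  simp only [dir, Pi.add_apply]
  ring

theorem ext_dir {x y : Fin 2 → ℝ} (h : ∀ φ, dir φ x = dir φ y) : x = y := by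
  have h0 := h 0
  have h1 := h (π / 2)
  simp only [dir, cos_zero, sin_zero, cos_pi_div_two, sin_pi_div_two, one_mul, zero_mul, add_zero,
    zero_add] at h0 h1
  ext i
  fin_cases i
  exacts [h0, h1]

theorem convex_setOf_dir_le (φ r : ℝ) : Convex ℝ {x | dir φ x ≤ r} := by
  intro x hx y hy a b ha hb hab
  simp only [Set.mem_ofPred_eq, dir_add, dir_smul] at *
  calc a * dir φ x + b * dir φ y ≤ a * r + b * r := by gcongr
    _ = r := by rw [← add_mul, hab, one_mul]

theorem convex_setOf_le_dir (φ r : ℝ) : Convex ℝ {x | r ≤ dir φ x} := by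
  intro x hx y hy a b ha hb hab
  simp only [Set.mem_ofPred_eq, dir_add, dir_smul] at *
  calc r = a * r + b * r := by rw [← add_mul, hab, one_mul]
    _ ≤ a * dir φ x + b * dir φ y := by gcongr

theorem Convex.smul_add_smul_add_smul_mem {E : Type*} [AddCommGroup E] [Module ℝ E] {s : Set E}
    (hs : Convex ℝ s) {x y z : E} (hx : x ∈ s) (hy : y ∈ s) (hz : z ∈ s) {a b c : ℝ}
    (ha : 0 ≤ a) (hb : 0 ≤ b) (hc : 0 ≤ c) (habc : a + b + c = 1) :
    a • x + b • y + c • z ∈ s := by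
  have := hs.sum_mem (t := Finset.univ) (w := ![a, b, c]) (z := ![x, y, z])
    (by intro i _; fin_cases i <;> assumption)
    (by simpa [Fin.sum_univ_three] using habc)
    (by intro i _; fin_cases i <;> assumption)
  simpa [Fin.sum_univ_three] using this

theorem pi_div_two_pow_le {n : ℕ} (hn : 2 ≤ n) : π / 2 ^ n ≤ π / 4 := by
  have : (2 : ℝ) ^ 2 ≤ 2 ^ n := pow_le_pow_right₀ (by norm_num) hn
  exact div_le_div_of_nonneg_left pi_pos.le (by norm_num) (by linarith)

theorem cos_pi_div_two_pow_pos {n : ℕ} (hn : 2 ≤ n) : 0 < cos (π / 2 ^ n) := by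
  have h0 : 0 < π / 2 ^ n := by positivity
  apply cos_pos_of_mem_Ioo
  constructor <;> linarith [pi_div_two_pow_le hn, pi_pos]

theorem dir_vtx (n ℓ : ℕ) (φ : ℝ) :
    dir φ (vtx n ℓ) = (cos (π / 2 ^ n))⁻¹ * cos (φ - (2 * ℓ + 1) * π / 2 ^ n) := by
  simp [dir, vtx, cos_sub]
  ring

theorem dir_wpt (n ℓ : ℕ) (φ : ℝ) :
    dir φ (wpt n ℓ) = cos (φ - (2 * ℓ + 2) * π / 2 ^ n) := by
  simp [dir, wpt, cos_sub]

/-! ### The chain of rotations and reflections -/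

theorem chainAux_succ {n : ℕ} (b : Fin n → Fin 2) (x : Fin 2 → ℝ) (i : Fin n) :
    chainAux n b x (i + 1) = (reflM ^ (b i : ℕ)) *ᵥ (rotM i *ᵥ chainAux n b x i) := by
  simp [chainAux]

theorem dir_reflM_pow_mulVec (a : Fin 2) (φ : ℝ) (x : Fin 2 → ℝ) :
    dir φ ((reflM ^ (a : ℕ)) *ᵥ x) = dir ((-1) ^ (a : ℕ) * φ) x := by
  fin_cases a <;> simp [dir, reflM, Matrix.vecHead, Matrix.vecTail]

theorem dir_rotM_mulVec (j : ℕ) (φ : ℝ) (x : Fin 2 → ℝ) :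
    dir φ (rotM j *ᵥ x) = dir (π / 2 ^ j + φ) x := by
  simp [dir, rotM, cos_add, sin_add, Matrix.vecHead, Matrix.vecTail]
  ring

theorem dir_chainAux_succ {n : ℕ} (b : Fin n → Fin 2) (x : Fin 2 → ℝ) (i : Fin n) (φ : ℝ) :
    dir φ (chainAux n b x (i + 1)) =
      dir (π / 2 ^ (i : ℕ) + (-1) ^ (b i : ℕ) * φ) (chainAux n b x i) := by
  rw [chainAux_succ, dir_reflM_pow_mulVec, dir_rotM_mulVec]

theorem exists_dir_chainAux {n : ℕ} (b : Fin n → Fin 2) (i : ℕ) (hi : i ≤ n) :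
    ∃ ψ σ : ℝ, (σ = 1 ∨ σ = -1) ∧ ∀ x φ, dir φ (chainAux n b x i) = dir (ψ + σ * φ) x := by
  induction i with
  | zero => exact ⟨0, 1, Or.inl rfl, fun x φ => by simp [chainAux]⟩
  | succ i ih =>
    obtain ⟨ψ, σ, hσ, h⟩ := ih (by omega)
    refine ⟨ψ + σ * (π / 2 ^ i), σ * (-1) ^ (b ⟨i, hi⟩ : ℕ), ?_, fun x φ => ?_⟩
    · rcases neg_one_pow_eq_or ℝ (b ⟨i, hi⟩ : ℕ) with h' | h' <;>
        rcases hσ with rfl | rfl <;> simp [h']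
    · have := dir_chainAux_succ b x ⟨i, hi⟩ φ
      simp only at this
      rw [this, h]
      ring_nf

theorem chainAux_injective {n : ℕ} (b : Fin n → Fin 2) :
    Function.Injective fun x => chainAux n b x n := by
  intro x y hxy
  obtain ⟨ψ, σ, hσ, h⟩ := exists_dir_chainAux b n le_rfl
  refine ext_dir fun φ => ?_
  have hφ : φ = ψ + σ * (σ * (φ - ψ)) := by rcases hσ with rfl | rfl <;> ring
  rw [hφ, ← h, ← h]
  exact congrArg _ hxy

/-- A chain that carries `v_ℓ` to `v_0` carries the cone of `w_{ℓ-1}` and `w_ℓ` to the cone of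
`w_{-1}` and `w_0`, possibly exchanging the two rays. -/
theorem exists_dir_chainAux_vtx {n ℓ : ℕ} (hc : 0 < cos (π / 2 ^ n)) {b : Fin n → Fin 2}
    (hb : chainAux n b (vtx n ℓ) n = vtx n 0) :
    ∃ σ : ℝ, (σ = 1 ∨ σ = -1) ∧ ∀ x φ, dir (π / 2 ^ n + φ) (chainAux n b x n) =
      dir ((2 * ℓ + 1) * π / 2 ^ n + σ * φ) x := by
  obtain ⟨ψ, σ, hσ, h⟩ := exists_dir_chainAux b n le_rfl
  refine ⟨σ, hσ, fun x φ => ?_⟩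
  have h1 : cos (ψ + σ * (π / 2 ^ n) - (2 * ℓ + 1) * π / 2 ^ n) = 1 := by
    have := h (vtx n ℓ) (π / 2 ^ n)
    rw [hb, dir_vtx, dir_vtx] at this
    have h2 := mul_left_cancel₀ (inv_ne_zero hc.ne') this
    rw [← h2]
    simp
  obtain ⟨m, hm⟩ := (cos_eq_one_iff _).1 h1
  have h3 : ψ + σ * (π / 2 ^ n + φ) = (2 * ℓ + 1) * π / 2 ^ n + σ * φ + m * (2 * π) := by
    linear_combination -hm
  rw [h, h3]
  simp only [dir, cos_add_int_mul_two_pi, sin_add_int_mul_two_pi]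

theorem dir_chainAux_vtx {n ℓ : ℕ} (hc : 0 < cos (π / 2 ^ n)) {b : Fin n → Fin 2}
    (hb : chainAux n b (vtx n ℓ) n = vtx n 0) (x : Fin 2 → ℝ) :
    dir (π / 2 ^ n) (chainAux n b x n) = dir ((2 * ℓ + 1) * π / 2 ^ n) x := by
  obtain ⟨σ, -, h⟩ := exists_dir_chainAux_vtx hc hb
  simpa using h x 0

theorem vtx_injOn {n : ℕ} (hc : 0 < cos (π / 2 ^ n)) :
    Set.InjOn (vtx n) (Set.Iio (2 ^ n)) := by
  intro ℓ hℓ m hm h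
  have h1 := dir_vtx n ℓ ((2 * m + 1) * π / 2 ^ n)
  rw [h, dir_vtx] at h1
  have h2 := mul_left_cancel₀ (inv_ne_zero hc.ne') h1
  rw [sub_self, cos_zero] at h2
  have hk : (0 : ℝ) < 2 ^ n := by positivity
  have hℓ' : (ℓ : ℝ) < 2 ^ n := by exact_mod_cast hℓ
  have hm' : (m : ℝ) < 2 ^ n := by exact_mod_cast hm
  have h3 : (2 * m + 1) * π / 2 ^ n - (2 * ℓ + 1) * π / 2 ^ n
      = (((m : ℝ) - ℓ) / 2 ^ n) * (2 * π) := by ring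
  have h4 : ((m : ℝ) - ℓ) / 2 ^ n < 1 := by
    rw [div_lt_one hk]; linarith [(Nat.cast_nonneg ℓ : (0 : ℝ) ≤ ℓ)]
  have h5 : -1 < ((m : ℝ) - ℓ) / 2 ^ n := by
    rw [lt_div_iff₀ hk]; linarith [(Nat.cast_nonneg m : (0 : ℝ) ≤ m)]
  rw [h3] at h2
  have h6 := (cos_eq_one_iff_of_lt_of_lt (by nlinarith [pi_pos]) (by nlinarith [pi_pos])).1 h2.symm
  have h7 : (m : ℝ) - ℓ = 0 := by
    rcases mul_eq_zero.1 h6 with h | h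
    · exact (div_eq_zero_iff.1 h).resolve_right hk.ne'
    · exact absurd h (by positivity)
  exact_mod_cast (sub_eq_zero.1 h7).symm

theorem exists_eq_of_chainAux_vtx {n : ℕ} (hc : 0 < cos (π / 2 ^ n)) {b : ℕ → Fin n → Fin 2}
    (hb : ∀ ℓ < 2 ^ n, chainAux n (b ℓ) (vtx n ℓ) n = vtx n 0) (b' : Fin n → Fin 2) :
    ∃ ℓ < 2 ^ n, b' = b ℓ := by
  have hinj : Function.Injective fun ℓ : Fin (2 ^ n) => b ℓ := by
    intro ℓ m h
    apply Fin.ext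
    apply vtx_injOn hc ℓ.2 m.2
    apply chainAux_injective (b ℓ)
    change chainAux n (b ℓ) _ n = chainAux n (b ℓ) _ n
    rw [hb ℓ ℓ.2]
    simp only at h
    rw [h, hb m m.2]
  obtain ⟨ℓ, hℓ⟩ := ((Fintype.bijective_iff_injective_and_card _).2 ⟨hinj, by simp⟩).2 b'
  exact ⟨ℓ, ℓ.2, hℓ.symm⟩

/-! ### The projections -/

/-- Iterates rotation, folding into the upper half plane except at the indices in `e`. -/
noncomputable def foldChain (n : ℕ) (e : Finset (Fin n)) (x : Fin 2 → ℝ) : ℕ → Fin 2 → ℝ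
  | 0 => x
  | i + 1 =>
    if h : i < n then
      if ⟨i, h⟩ ∈ e ∨ 0 ≤ (rotM i *ᵥ foldChain n e x i) 1 then rotM i *ᵥ foldChain n e x i
      else reflM *ᵥ (rotM i *ᵥ foldChain n e x i)
    else foldChain n e x i

theorem exists_chainAux_fold {n : ℕ} (e : Finset (Fin n)) (x : Fin 2 → ℝ) :
    ∃ b : Fin n → Fin 2, (∀ i ∈ e, b i = 0) ∧
      ∀ i : Fin n, i ∉ e → 0 ≤ chainAux n b x (i + 1) 1 := by
  let b : Fin n → Fin 2 := fun i =>
    if i ∈ e ∨ 0 ≤ (rotM i *ᵥ foldChain n e x i) 1 then 0 else 1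
  have hch : ∀ i ≤ n, chainAux n b x i = foldChain n e x i := by
    intro i hi
    induction i with
    | zero => rfl
    | succ i ih =>
      have := chainAux_succ b x ⟨i, hi⟩
      simp only at this
      rw [this, ih (by omega), foldChain, dif_pos (show i < n from hi)]
      by_cases h : ⟨i, hi⟩ ∈ e ∨ 0 ≤ (rotM i *ᵥ foldChain n e x i) 1
      · rw [if_pos h, show b ⟨i, hi⟩ = 0 from if_pos h, Fin.val_zero, pow_zero, one_mulVec]
      · rw [if_neg h, show b ⟨i, hi⟩ = 1 from if_neg h, Fin.val_one, pow_one]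
  refine ⟨b, fun i hi => by simp [b, hi], fun i hi => ?_⟩
  rw [hch _ i.2, foldChain, dif_pos i.2]
  split_ifs with h
  · exact h.resolve_left hi
  · push Not at h
    have := h.2
    simp only [reflM, Matrix.mulVec, dotProduct, Fin.sum_univ_two] at this ⊢
    simp at this ⊢
    linarith

theorem rotM_mulVec_zero (j : ℕ) (x : Fin 2 → ℝ) :
    (rotM j *ᵥ x) 0 = cos (π / 2 ^ j) * x 0 + sin (π / 2 ^ j) * x 1 := by
  simp [rotM, Matrix.vecHead, Matrix.vecTail]

theorem rotM_mulVec_one (j : ℕ) (x : Fin 2 → ℝ) :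
    (rotM j *ᵥ x) 1 = -sin (π / 2 ^ j) * x 0 + cos (π / 2 ^ j) * x 1 := by
  simp [rotM, Matrix.vecHead, Matrix.vecTail]

/-- The relations between consecutive coordinates that `Pempty` and `Pe` have in common. -/
def StepRel (n : ℕ) (e : Finset (Fin n)) (p : (Fin (n + 1) → ℝ) × (Fin (n + 1) → ℝ)) : Prop :=
  ∀ i : Fin n,
    p.1 i.succ = cos (π / 2 ^ (i : ℕ)) * p.1 i.castSucc
        + sin (π / 2 ^ (i : ℕ)) * p.2 i.castSucc ∧
    (if i ∈ e then
      p.2 i.succ = -sin (π / 2 ^ (i : ℕ)) * p.1 i.castSucc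
          + cos (π / 2 ^ (i : ℕ)) * p.2 i.castSucc
    else
      p.2 i.succ ≥ -sin (π / 2 ^ (i : ℕ)) * p.1 i.castSucc
          + cos (π / 2 ^ (i : ℕ)) * p.2 i.castSucc ∧
      p.2 i.succ ≥ sin (π / 2 ^ (i : ℕ)) * p.1 i.castSucc
          - cos (π / 2 ^ (i : ℕ)) * p.2 i.castSucc)

theorem StepRel.dir_chainAux_le {n : ℕ} {e : Finset (Fin n)}
    {p : (Fin (n + 1) → ℝ) × (Fin (n + 1) → ℝ)} (hp : StepRel n e p) {b : Fin n → Fin 2}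
    (hb : ∀ i ∈ e, b i = 0) (i : Fin (n + 1)) :
    ∀ φ, 0 ≤ φ → φ ≤ 2 * π / 2 ^ (i : ℕ) →
      dir φ (chainAux n b (proj2 p) i) ≤ dir φ ![p.1 i, p.2 i] := by
  induction i using Fin.induction with
  | zero => intro φ _ _; rfl
  | succ i ih =>
    intro φ h0 h1
    have h1' : φ ≤ π / 2 ^ (i : ℕ) := by
      rw [Fin.val_succ, pow_succ'] at h1
      rwa [mul_div_mul_left _ _ two_ne_zero] at h1
    have hle : π / 2 ^ (i : ℕ) ≤ π :=
      div_le_self pi_pos.le (one_le_pow₀ (by norm_num))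
    have hs : 0 ≤ sin φ := sin_nonneg_of_nonneg_of_le_pi h0 (h1'.trans hle)
    have h2 : 2 * π / 2 ^ (i : ℕ) = π / 2 ^ (i : ℕ) + π / 2 ^ (i : ℕ) := by ring
    rw [Fin.val_succ, dir_chainAux_succ]
    obtain ⟨hy, hz⟩ := hp i
    rw [Fin.val_castSucc, h2] at ih
    by_cases hi : b i = 0
    · have hz' : p.2 i.succ ≥ -sin (π / 2 ^ (i : ℕ)) * p.1 i.castSucc
          + cos (π / 2 ^ (i : ℕ)) * p.2 i.castSucc := by
        split_ifs at hz
        exacts [hz.ge, hz.1]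
      have := ih (π / 2 ^ (i : ℕ) + φ) (by positivity) (by linarith)
      simp only [hi, Fin.val_zero, pow_zero, one_mul]
      refine this.trans ?_
      have := mul_le_mul_of_nonneg_left hz' hs
      simp only [dir, cos_add, sin_add, Matrix.cons_val_zero, Matrix.cons_val_one, hy]
      linarith
    · have hie : i ∉ e := fun h => hi (hb i h)
      rw [if_neg hie] at hz
      have hi1 : b i = 1 := by omega
      have := ih (π / 2 ^ (i : ℕ) + -1 * φ) (by linarith) (by linarith)
      simp only [hi1, Fin.val_one, pow_one]
      refine this.trans ?_
      have := mul_le_mul_of_nonneg_left hz.2 hs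
      rw [neg_one_mul]
      simp only [dir, cos_add, sin_add, cos_neg, sin_neg, Matrix.cons_val_zero,
        Matrix.cons_val_one, hy]
      linarith

theorem exists_stepRel {n : ℕ} (e : Finset (Fin n)) (x : Fin 2 → ℝ) :
    ∃ p b, StepRel n e p ∧ (∀ i ∈ e, b i = 0) ∧ proj2 p = x ∧
      ∀ φ, cos φ * p.1 (Fin.last n) + sin φ * p.2 (Fin.last n) = dir φ (chainAux n b x n) := by
  obtain ⟨b, hb, hnn⟩ := exists_chainAux_fold e x
  refine ⟨⟨fun i => chainAux n b x i 0, fun i => chainAux n b x i 1⟩, b, fun i => ?_, hb, ?_,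
    fun φ => by simp [dir]⟩
  · have hs := chainAux_succ b x i
    have hn1 := hnn i
    rw [← rotM_mulVec_zero, ← rotM_mulVec_one]
    have hsub : sin (π / 2 ^ (i : ℕ)) * chainAux n b x i 0
        - cos (π / 2 ^ (i : ℕ)) * chainAux n b x i 1 = -(rotM i *ᵥ chainAux n b x i) 1 := by
      rw [rotM_mulVec_one]; ring
    simp only [Fin.val_succ, Fin.val_castSucc]
    rw [hsub]
    by_cases hi : b i = 0
    · simp only [hi, Fin.val_zero, pow_zero, one_mulVec] at hs
      rw [hs] at hn1 ⊢
      refine ⟨rfl, ?_⟩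
      split_ifs with h
      · rfl
      · exact ⟨le_rfl, by linarith [hn1 h]⟩
    · have hie : i ∉ e := fun h => hi (hb i h)
      have hi1 : b i = 1 := by omega
      have h0 : chainAux n b x (i + 1) 0 = (rotM i *ᵥ chainAux n b x i) 0 := by
        rw [hs, hi1]; simp [reflM]
      have h1 : chainAux n b x (i + 1) 1 = -(rotM i *ᵥ chainAux n b x i) 1 := by
        rw [hs, hi1]; simp [reflM]
      have := hn1 hie
      rw [if_neg hie, h0, h1]
      exact ⟨rfl, by linarith, le_rfl⟩
  · ext i
    fin_cases i <;> simp [proj2, chainAux]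

theorem mem_proj2_image_Pe {n : ℕ} {e : Finset (Fin n)} {x : Fin 2 → ℝ} :
    x ∈ proj2 '' Pe n e ↔ ∀ b : Fin n → Fin 2, (∀ i ∈ e, b i = 0) →
      dir (π / 2 ^ n) (chainAux n b x n) ≤ cos (π / 2 ^ n) := by
  constructor
  · rintro ⟨p, ⟨hp, hl⟩, rfl⟩ b hb
    have := StepRel.dir_chainAux_le hp hb (Fin.last n) (π / 2 ^ n) (by positivity)
      (by rw [Fin.val_last]; gcongr; linarith [pi_pos])
    exact this.trans hl
  · intro h
    obtain ⟨p, b, hp, hb, rfl, hdir⟩ := exists_stepRel e x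
    exact ⟨p, ⟨hp, (hdir _).trans_le (h b hb)⟩, rfl⟩

theorem mem_proj2_image_Pempty_iff_chainAux {n : ℕ} (hn : 1 ≤ n) {x : Fin 2 → ℝ} :
    x ∈ proj2 '' Pempty n ↔ ∀ b : Fin n → Fin 2,
      dir 0 (chainAux n b x n) ≤ 1 ∧ dir (π / 2 ^ (n - 1)) (chainAux n b x n) ≤ 1 := by
  have hstep : ∀ p, p ∈ Pempty n ↔ StepRel n ∅ p ∧ p.1 (Fin.last n) ≤ 1 ∧
      cos (π / 2 ^ (n - 1)) * p.1 (Fin.last n) + sin (π / 2 ^ (n - 1)) * p.2 (Fin.last n) ≤ 1 := by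
    intro p
    simp [Pempty, StepRel]
  have hangle : 2 * π / 2 ^ n = π / 2 ^ (n - 1) := by
    obtain ⟨m, rfl⟩ : ∃ m, n = m + 1 := ⟨n - 1, by omega⟩
    rw [pow_succ', mul_div_mul_left _ _ two_ne_zero, Nat.add_sub_cancel]
  constructor
  · rintro ⟨p, hp, rfl⟩ b
    obtain ⟨hp, h0, h1⟩ := (hstep p).1 hp
    have key := StepRel.dir_chainAux_le hp (b := b) (by simp) (Fin.last n)
    rw [Fin.val_last, hangle] at key
    refine ⟨(key 0 le_rfl (by positivity)).trans ?_, (key _ (by positivity) le_rfl).trans h1⟩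
    simpa [dir] using h0
  · intro h
    obtain ⟨p, b, hp, -, rfl, hdir⟩ := exists_stepRel (n := n) ∅ x
    refine ⟨p, (hstep p).2 ⟨hp, ?_, (hdir _).trans_le (h b).2⟩, rfl⟩
    have := (hdir 0).trans_le (h b).1
    simpa using this

theorem mem_proj2_image_Pempty {n : ℕ} (hn : 2 ≤ n) {b : ℕ → Fin n → Fin 2}
    (hb : ∀ ℓ < 2 ^ n, chainAux n (b ℓ) (vtx n ℓ) n = vtx n 0) {x : Fin 2 → ℝ} :
    x ∈ proj2 '' Pempty n ↔ ∀ ℓ : ℕ, ℓ < 2 ^ n →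
      dir (2 * ℓ * π / 2 ^ n) x ≤ 1 ∧ dir ((2 * ℓ + 2) * π / 2 ^ n) x ≤ 1 := by
  have hc := cos_pi_div_two_pow_pos hn
  have hangle : π / 2 ^ (n - 1) = π / 2 ^ n + π / 2 ^ n := by
    obtain ⟨m, rfl⟩ : ∃ m, n = m + 1 := ⟨n - 1, by omega⟩
    rw [pow_succ', Nat.add_sub_cancel]
    field_simp
    ring
  have key : ∀ ℓ < 2 ^ n, (dir 0 (chainAux n (b ℓ) x n) ≤ 1 ∧
      dir (π / 2 ^ (n - 1)) (chainAux n (b ℓ) x n) ≤ 1 ↔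
      dir (2 * ℓ * π / 2 ^ n) x ≤ 1 ∧ dir ((2 * ℓ + 2) * π / 2 ^ n) x ≤ 1) := by
    intro ℓ hℓ
    obtain ⟨σ, hσ, h⟩ := exists_dir_chainAux_vtx hc (hb ℓ hℓ)
    have h0 := h x (-(π / 2 ^ n))
    have h1 := h x (π / 2 ^ n)
    rw [add_neg_cancel] at h0
    rw [hangle, h0, h1]
    have e0 : (2 * ℓ + 1) * π / 2 ^ n + -(π / 2 ^ n) = 2 * ℓ * π / 2 ^ n := by ring
    have e1 : (2 * ℓ + 1) * π / 2 ^ n + π / 2 ^ n = (2 * ℓ + 2) * π / 2 ^ n := by ring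
    rcases hσ with rfl | rfl
    · rw [one_mul, one_mul, e0, e1]
    · rw [neg_one_mul, neg_one_mul, neg_neg, e0, e1, and_comm]
  rw [mem_proj2_image_Pempty_iff_chainAux (by omega)]
  constructor
  · exact fun h ℓ hℓ => (key ℓ hℓ).1 (h _)
  · intro h b'
    obtain ⟨ℓ, hℓ, rfl⟩ := exists_eq_of_chainAux_vtx hc hb b'
    exact (key ℓ hℓ).2 (h ℓ hℓ)

/-! ### The polygon and its corner triangles -/

theorem vtx_mem_Qgon {n ℓ : ℕ} (hℓ : ℓ < 2 ^ n) : vtx n ℓ ∈ Qgon n :=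
  subset_convexHull ℝ _ ⟨ℓ, hℓ, rfl⟩

theorem vtx_two_pow (n : ℕ) : vtx n (2 ^ n) = vtx n 0 := by
  have h : (2 * ((2 ^ n : ℕ) : ℝ) + 1) * π / 2 ^ n = (2 * ((0 : ℕ) : ℝ) + 1) * π / 2 ^ n + 2 * π := by
    push_cast
    field_simp
    ring
  rw [vtx, h, cos_add_two_pi, sin_add_two_pi, vtx]

theorem vtx_succ_mem_Qgon {n ℓ : ℕ} (hℓ : ℓ < 2 ^ n) : vtx n (ℓ + 1) ∈ Qgon n := by
  rcases Nat.lt_or_ge (ℓ + 1) (2 ^ n) with h | h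
  · exact vtx_mem_Qgon h
  · rw [show ℓ + 1 = 2 ^ n by omega, vtx_two_pow]
    exact vtx_mem_Qgon (by positivity)

theorem zero_mem_Qgon {n : ℕ} (hn : 2 ≤ n) : (0 : Fin 2 → ℝ) ∈ Qgon n := by
  have hlt : 2 ^ (n - 1) < 2 ^ n := Nat.pow_lt_pow_right (by norm_num) (by omega)
  have h := convex_convexHull ℝ _ (vtx_mem_Qgon (n := n) (ℓ := 0) (by positivity))
    (vtx_mem_Qgon hlt) (a := 1 / 2) (b := 1 / 2) (by norm_num) (by norm_num) (by norm_num)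
  have hα : (2 * ((2 ^ (n - 1) : ℕ) : ℝ) + 1) * π / 2 ^ n =
      (2 * ((0 : ℕ) : ℝ) + 1) * π / 2 ^ n + π := by
    obtain ⟨m, rfl⟩ : ∃ m, n = m + 1 := ⟨n - 1, by omega⟩
    rw [Nat.add_sub_cancel, pow_succ']
    push_cast
    field_simp
    ring
  refine Set.mem_of_eq_of_mem (ext_dir fun φ => ?_) h
  rw [dir_add, dir_smul, dir_smul, dir_vtx, dir_vtx, hα, ← sub_sub, cos_sub_pi]
  simp [dir]

theorem cos_odd_mul_pi_div_le {k : ℝ} (hk : 1 ≤ k) {t : ℝ} (h1 : 1 ≤ |t|) (h2 : |t| ≤ 2 * k - 1) :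
    cos (t * π / k) ≤ cos (π / k) := by
  have hk0 : 0 < k := by linarith
  have hk1 : 0 ≤ π / k := by positivity
  have hkk : k * (π / k) = π := by field_simp
  rw [← cos_abs (t * π / k), mul_div_assoc, abs_mul, abs_of_nonneg hk1]
  rcases le_total |t| k with h | h
  · exact cos_le_cos_of_nonneg_of_le_pi hk1 (by nlinarith) (by nlinarith)
  · rw [← cos_two_pi_sub (|t| * _)]
    exact cos_le_cos_of_nonneg_of_le_pi hk1 (by nlinarith) (by nlinarith)

theorem exists_sector {n : ℕ} (x : Fin 2 → ℝ) :
    ∃ ℓ : ℕ, ℓ < 2 ^ n ∧ ∃ r θ : ℝ, 0 ≤ r ∧ x = r • ![cos θ, sin θ] ∧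
      (2 * ℓ + 1) * π / 2 ^ n ≤ θ ∧ θ ≤ (2 * ℓ + 3) * π / 2 ^ n := by
  let z : ℂ := ⟨x 0, x 1⟩
  let j : ℤ := ⌊(z.arg * 2 ^ n / π - 1) / 2⌋
  have hk : (0 : ℤ) < 2 ^ n := by positivity
  have hk' : (0 : ℝ) < 2 ^ n := by positivity
  have hmod : (j % 2 ^ n : ℤ) + 2 ^ n * (j / 2 ^ n) = j := Int.emod_add_mul_ediv j _
  have hnn := Int.emod_nonneg j hk.ne'
  have hlt := Int.emod_lt_of_pos j hk
  obtain ⟨ℓ, hℓ⟩ := Int.eq_ofNat_of_zero_le hnn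
  have hmod' : (j : ℝ) = ℓ + 2 ^ n * ((j / 2 ^ n : ℤ) : ℝ) := by
    rw [hℓ] at hmod
    exact_mod_cast hmod.symm
  have hj1 : (j : ℝ) ≤ (z.arg * 2 ^ n / π - 1) / 2 := Int.floor_le _
  have hj2 : (z.arg * 2 ^ n / π - 1) / 2 < j + 1 := Int.lt_floor_add_one _
  have hπ := pi_pos
  refine ⟨ℓ, by rw [hℓ] at hlt; exact_mod_cast hlt, ‖z‖,
    z.arg - ((j / 2 ^ n : ℤ) : ℝ) * (2 * π), norm_nonneg z, ?_, ?_, ?_⟩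
  · rw [cos_sub_int_mul_two_pi, sin_sub_int_mul_two_pi]
    ext i
    fin_cases i
    · simp [z]
    · simp [z]
  · have h : (2 * j + 1) * π ≤ z.arg * 2 ^ n := by
      rw [← le_div_iff₀ hπ]; linarith
    rw [div_le_iff₀ hk']
    rw [hmod'] at h
    linarith
  · have h : z.arg * 2 ^ n ≤ (2 * j + 3) * π := by
      rw [← div_le_iff₀ hπ]; linarith
    rw [le_div_iff₀ hk']
    rw [hmod'] at h
    linarith

theorem mem_Qgon_iff {n : ℕ} (hn : 2 ≤ n) {x : Fin 2 → ℝ} :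
    x ∈ Qgon n ↔ ∀ ℓ : ℕ, ℓ < 2 ^ n →
      dir (2 * ℓ * π / 2 ^ n) x ≤ 1 ∧ dir ((2 * ℓ + 2) * π / 2 ^ n) x ≤ 1 := by
  have hc := cos_pi_div_two_pow_pos hn
  have hk : (1 : ℝ) ≤ 2 ^ n := one_le_pow₀ (by norm_num)
  have one_le_abs_cast : ∀ t : ℤ, t ≠ 0 → (1 : ℝ) ≤ |(t : ℝ)| := fun t ht => by
    exact_mod_cast Int.one_le_abs ht
  constructor
  · intro hx ℓ hℓ
    have bound : ∀ m : ℕ, m < 2 ^ n → ∀ t : ℤ, t = 2 * ℓ - (2 * m + 1) ∨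
        t = 2 * ℓ + 2 - (2 * m + 1) → cos (t * π / 2 ^ n) ≤ cos (π / 2 ^ n) := by
      intro m hm t ht
      apply cos_odd_mul_pi_div_le hk (one_le_abs_cast t (by omega))
      have h2 : |t| ≤ 2 * 2 ^ n - 1 := by
        have hℓ' : (ℓ : ℤ) < 2 ^ n := by exact_mod_cast hℓ
        have hm' : (m : ℤ) < 2 ^ n := by exact_mod_cast hm
        rw [abs_le]
        constructor <;> omega
      exact_mod_cast h2
    constructor
    · refine convexHull_min ?_ (convex_setOf_dir_le _ 1) hx
      rintro _ ⟨m, hm, rfl⟩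
      rw [Set.mem_ofPred_eq, dir_vtx, inv_mul_le_iff₀ hc, mul_one]
      refine (congrArg cos ?_).trans_le (bound m hm _ (Or.inl rfl))
      push_cast
      ring
    · refine convexHull_min ?_ (convex_setOf_dir_le _ 1) hx
      rintro _ ⟨m, hm, rfl⟩
      rw [Set.mem_ofPred_eq, dir_vtx, inv_mul_le_iff₀ hc, mul_one]
      refine (congrArg cos ?_).trans_le (bound m hm _ (Or.inr rfl))
      push_cast
      ring
  · intro h
    obtain ⟨ℓ, hℓ, r, θ, hr, hx, h1, h2⟩ := exists_sector (n := n) x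
    have hw := (h ℓ hℓ).2
    have hδ : 0 < π / 2 ^ n := by positivity
    have hδ4 := pi_div_two_pow_le hn
    set δ := π / 2 ^ n with hδdef
    have e1 : (2 * ℓ + 1) * π / 2 ^ n = (2 * ℓ + 2) * π / 2 ^ n - δ := by rw [hδdef]; ring
    have e3 : (2 * ℓ + 3) * π / 2 ^ n = (2 * ℓ + 2) * π / 2 ^ n + δ := by rw [hδdef]; ring
    have e3' : (2 * ((ℓ + 1 : ℕ) : ℝ) + 1) * π / 2 ^ n = (2 * ℓ + 2) * π / 2 ^ n + δ := by
      rw [hδdef]; push_cast; ring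
    rw [e1] at h1
    rw [e3] at h2
    set ω := (2 * ℓ + 2) * π / 2 ^ n with hω
    have hs : 0 < sin δ := sin_pos_of_pos_of_lt_pi hδ (by linarith [pi_pos])
    have hA : 0 ≤ sin (ω + δ - θ) :=
      sin_nonneg_of_nonneg_of_le_pi (by linarith) (by linarith [pi_pos])
    have hB : 0 ≤ sin (θ - (ω - δ)) :=
      sin_nonneg_of_nonneg_of_le_pi (by linarith) (by linarith [pi_pos])
    have hcomb : x = (r * sin (ω + δ - θ) / (2 * sin δ)) • vtx n ℓ
        + (r * sin (θ - (ω - δ)) / (2 * sin δ)) • vtx n (ℓ + 1) := by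
      refine ext_dir fun φ => ?_
      rw [dir_add, dir_smul, dir_smul, dir_vtx, dir_vtx, e1, e3', hx, dir_smul]
      obtain ⟨u, rfl⟩ : ∃ u, φ = ω + u := ⟨φ - ω, by ring⟩
      obtain ⟨t, rfl⟩ : ∃ t, θ = ω + t := ⟨θ - ω, by ring⟩
      have g1 : dir (ω + u) ![cos (ω + t), sin (ω + t)] = cos (u - t) := by
        simp only [dir, Matrix.cons_val_zero, Matrix.cons_val_one]
        rw [← cos_sub]
        ring_nf
      rw [g1, ← hδdef, show ω + δ - (ω + t) = δ - t by ring, show ω + t - (ω - δ) = t + δ by ring,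
        show ω + u - (ω - δ) = u + δ by ring, show ω + u - (ω + δ) = u - δ by ring]
      simp only [sin_sub, sin_add, cos_sub, cos_add]
      field_simp
      ring
    have hsum : dir ω x = r * sin (ω + δ - θ) / (2 * sin δ)
        + r * sin (θ - (ω - δ)) / (2 * sin δ) := by
      conv_lhs => rw [hcomb]
      rw [dir_add, dir_smul, dir_smul, dir_vtx, dir_vtx, e1, e3', ← hδdef, sub_sub_cancel,
        sub_add_cancel_left, cos_neg, inv_mul_cancel₀ hc.ne', mul_one, mul_one]
    rw [hsum] at hw
    have hfin := (convex_convexHull ℝ _).smul_add_smul_add_smul_mem (vtx_mem_Qgon hℓ)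
      (vtx_succ_mem_Qgon hℓ) (zero_mem_Qgon hn)
      (a := r * sin (ω + δ - θ) / (2 * sin δ)) (b := r * sin (θ - (ω - δ)) / (2 * sin δ))
      (by positivity) (by positivity) (sub_nonneg.2 hw) (by ring)
    rw [smul_zero, add_zero, ← hcomb] at hfin
    exact hfin

theorem wpt_add_two_pow_sub_one (n ℓ : ℕ) :
    wpt n (ℓ + 2 ^ n - 1) = ![cos (2 * ℓ * π / 2 ^ n), sin (2 * ℓ * π / 2 ^ n)] := by
  have h1 : 1 ≤ ℓ + 2 ^ n := le_add_left Nat.one_le_two_pow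
  have h : (2 * ((ℓ + 2 ^ n - 1 : ℕ) : ℝ) + 2) * π / 2 ^ n = 2 * ℓ * π / 2 ^ n + 2 * π := by
    rw [Nat.cast_sub h1]
    push_cast
    field_simp
    ring
  rw [wpt, h, cos_add_two_pi, sin_add_two_pi]

theorem mem_tri_iff {n ℓ : ℕ} (hn : 2 ≤ n) (hℓ : ℓ < 2 ^ n) {x : Fin 2 → ℝ} (hx : x ∈ Qgon n) :
    x ∈ tri n ℓ ↔ cos (π / 2 ^ n) ≤ dir ((2 * ℓ + 1) * π / 2 ^ n) x := by
  have hc := cos_pi_div_two_pow_pos hn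
  have hδ : 0 < π / 2 ^ n := by positivity
  have hs : 0 < sin (π / 2 ^ n) :=
    sin_pos_of_pos_of_lt_pi hδ (by linarith [pi_pos, pi_div_two_pow_le hn])
  obtain ⟨h0, h2⟩ := (mem_Qgon_iff hn).1 hx ℓ hℓ
  have e0 : 2 * ℓ * π / 2 ^ n = (2 * ℓ + 1) * π / 2 ^ n - π / 2 ^ n := by ring
  have e2 : (2 * ℓ + 2) * π / 2 ^ n = (2 * ℓ + 1) * π / 2 ^ n + π / 2 ^ n := by ring
  have hw : ∀ φ, dir φ (wpt n (ℓ + 2 ^ n - 1)) =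
      cos (φ - ((2 * ℓ + 1) * π / 2 ^ n - π / 2 ^ n)) := by
    intro φ
    rw [wpt_add_two_pow_sub_one, e0, cos_sub φ]
    rfl
  constructor
  · intro h
    refine convexHull_min ?_ (convex_setOf_le_dir _ _) h
    rintro _ (rfl | rfl | rfl)
    · rw [Set.mem_ofPred_eq, hw, sub_sub_cancel]
    · rw [Set.mem_ofPred_eq, dir_vtx, sub_self, cos_zero, mul_one]
      exact (cos_le_one _).trans ((one_le_inv₀ hc).2 (cos_le_one _))
    · rw [Set.mem_ofPred_eq, dir_wpt, e2, sub_add_cancel_left, cos_neg]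
  · intro h
    have hw' : ∀ φ, dir φ (wpt n ℓ) = cos (φ - ((2 * ℓ + 1) * π / 2 ^ n + π / 2 ^ n)) := by
      intro φ
      rw [dir_wpt, e2]
    have hv := dir_vtx n ℓ
    rw [e0] at h0
    rw [e2] at h2
    set α := (2 * ℓ + 1) * π / 2 ^ n
    set δ := π / 2 ^ n
    have hsq := sin_sq_add_cos_sq δ
    have hcomb : x = ((1 - dir (α + δ) x) / (2 * sin δ ^ 2)) • wpt n (ℓ + 2 ^ n - 1)
        + ((dir α x - cos δ) * cos δ / sin δ ^ 2) • vtx n ℓ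
        + ((1 - dir (α - δ) x) / (2 * sin δ ^ 2)) • wpt n ℓ := by
      refine ext_dir fun φ => ?_
      obtain ⟨u, rfl⟩ : ∃ u, φ = α + u := ⟨φ - α, by ring⟩
      have hd : ∀ t, dir (α + t) x =
          cos t * dir α x + sin t * (-sin α * x 0 + cos α * x 1) := by
        intro t
        simp only [dir, cos_add, sin_add]
        ring
      rw [dir_add, dir_add, dir_smul, dir_smul, dir_smul, hw, hw', hv,
        show α + u - (α - δ) = u + δ by ring, show α + u - (α + δ) = u - δ by ring,
        add_sub_cancel_left, sub_eq_add_neg α δ, hd u, hd δ, hd (-δ), cos_neg, sin_neg, cos_add u,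
        cos_sub u]
      generalize dir α x = p
      generalize -sin α * x 0 + cos α * x 1 = q
      field_simp
      linear_combination (cos u * p * 2) * hsq
    rw [hcomb]
    refine (convex_convexHull ℝ _).smul_add_smul_add_smul_mem
      (subset_convexHull ℝ _ (by simp)) (subset_convexHull ℝ _ (by simp))
      (subset_convexHull ℝ _ (by simp)) (div_nonneg (by linarith) (by positivity))
      (div_nonneg (mul_nonneg (by linarith) hc.le) (by positivity))
      (div_nonneg (by linarith) (by positivity)) ?_
    have hd : dir (α + δ) x + dir (α - δ) x = 2 * cos δ * dir α x := by
      simp only [dir, cos_add, sin_add, cos_sub, sin_sub]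
      ring
    field_simp
    linear_combination -hd - 2 * hsq

/-- For each two-element edge `e`, the intersection of the projections of `P^∅_n` and `P^e_n`
onto `(y_1, z_1)` equals the closure of `Q_{2^n}` minus the triangles `Δ_ℓ` for all `ℓ`
whose associated set `S_ℓ = {i : b^ℓ_i = 0}` contains `e`. -/
theorem proj_inter_eq_closure_diff (n : ℕ) (hn : 2 ≤ n)
    (e : Finset (Fin n)) (he : e.card = 2)
    (b : ℕ → Fin n → Fin 2)
    (hb : ∀ ℓ < 2 ^ n, chainAux n (b ℓ) (vtx n ℓ) n = vtx n 0) :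
    (proj2 '' Pempty n) ∩ (proj2 '' Pe n e)
      = closure (Qgon n \ ⋃ ℓ ∈ {ℓ : ℕ | ℓ < 2 ^ n ∧ ∀ i ∈ e, b ℓ i = 0}, tri n ℓ) := by
  have hc := cos_pi_div_two_pow_pos hn
  have hmem := fun x => mem_proj2_image_Pempty (x := x) hn hb
  have hL : ∀ x, x ∈ proj2 '' Pe n e ↔
      ∀ ℓ, ℓ < 2 ^ n → (∀ i ∈ e, b ℓ i = 0) →
        dir ((2 * ℓ + 1) * π / 2 ^ n) x ≤ cos (π / 2 ^ n) := by
    intro x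
    rw [mem_proj2_image_Pe]
    constructor
    · intro h ℓ hℓ hbe
      rw [← dir_chainAux_vtx hc (hb ℓ hℓ) x]
      exact h _ hbe
    · intro h b' hb'
      obtain ⟨ℓ, hℓ, rfl⟩ := exists_eq_of_chainAux_vtx hc hb b'
      rw [dir_chainAux_vtx hc (hb ℓ hℓ) x]
      exact h ℓ hℓ hb'
  have hS : Qgon n \ ⋃ ℓ ∈ {ℓ : ℕ | ℓ < 2 ^ n ∧ ∀ i ∈ e, b ℓ i = 0}, tri n ℓ =
      {x | x ∈ Qgon n ∧ ∀ ℓ, ℓ < 2 ^ n → (∀ i ∈ e, b ℓ i = 0) →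
        dir ((2 * ℓ + 1) * π / 2 ^ n) x < cos (π / 2 ^ n)} := by
    ext x
    simp only [Set.mem_sdiff, Set.mem_iUnion, Set.mem_ofPred_eq, not_exists, exists_prop, not_and]
    refine and_congr_right fun hx => forall_congr' fun ℓ => ?_
    rw [and_imp]
    refine forall_congr' fun hℓ => forall_congr' fun _ => ?_
    rw [mem_tri_iff hn hℓ hx, not_le]
  rw [hS]
  apply Set.Subset.antisymm
  · rintro x ⟨hx, hxe⟩
    rw [hmem, ← mem_Qgon_iff hn] at hx
    rw [hL] at hxe
    have hsub : openSegment ℝ 0 x ⊆ {x | x ∈ Qgon n ∧ ∀ ℓ, ℓ < 2 ^ n → (∀ i ∈ e, b ℓ i = 0) →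
        dir ((2 * ℓ + 1) * π / 2 ^ n) x < cos (π / 2 ^ n)} := by
      rintro _ ⟨s, t, hs, ht, hst, rfl⟩
      refine ⟨convex_convexHull ℝ _ (zero_mem_Qgon hn) hx hs.le ht.le hst, fun ℓ hℓ hbe => ?_⟩
      rw [smul_zero, zero_add, dir_smul]
      nlinarith [hxe ℓ hℓ hbe]
    apply closure_mono hsub
    rw [closure_openSegment]
    exact right_mem_segment ℝ 0 x
  · apply closure_minimal
    · rintro x ⟨hx, hxe⟩
      exact ⟨(hmem x).2 ((mem_Qgon_iff hn).1 hx), (hL x).2 fun ℓ hℓ hbe => (hxe ℓ hℓ hbe).le⟩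
    · have : proj2 '' Pempty n ∩ proj2 '' Pe n e =
          (⋂ ℓ : ℕ, ⋂ (_ : ℓ < 2 ^ n), ({x | dir (2 * ℓ * π / 2 ^ n) x ≤ 1} ∩
            {x | dir ((2 * ℓ + 2) * π / 2 ^ n) x ≤ 1})) ∩
          ⋂ ℓ : ℕ, ⋂ (_ : ℓ < 2 ^ n), ⋂ (_ : ∀ i ∈ e, b ℓ i = 0),
            {x | dir ((2 * ℓ + 1) * π / 2 ^ n) x ≤ cos (π / 2 ^ n)} := by
        ext x
        rw [Set.mem_inter_iff, hmem, hL]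
        simp only [Set.mem_inter_iff, Set.mem_iInter, Set.mem_ofPred_eq]
      rw [this]
      refine IsClosed.inter (isClosed_iInter fun ℓ => isClosed_iInter fun _ => ?_)
        (isClosed_iInter fun ℓ => isClosed_iInter fun _ => isClosed_iInter fun _ => ?_)
      · exact (isClosed_le (continuous_dir _) continuous_const).inter
          (isClosed_le (continuous_dir _) continuous_const)
      · exact isClosed_le (continuous_dir _) continuous_const
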